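/- arXiv:1902.08557 — 3 statements merged into one kernel-verified Lean document; each statement's English description precedes it below -/
import Mathlib

section
/- Assume t is even. For linear codes C₁, C₂ of length n over 𝔽_q, the Hermitian dual of the linear code C = vC₁ ⊕ (1−v)C₂ over R is C^{⊥_H} = vC₁^{⊥_H} ⊕ (1−v)C₂^{⊥_H}, where C₁^{⊥_H} and C₂^{⊥_H} are the Hermitian duals of C₁ and C₂ in 𝔽_qⁿ. -/
open scoped BigOperators

/-- The ring `R = 𝔽_q + v 𝔽_q`, `v² = v`, realized concretely as `F × F`
via the `F`-algebra isomorphism `a + v b ↦ (a, a + b)`. -/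
abbrev Rg (F : Type) := F × F

/-- The element `v` of `R`: under the identification above, `v = (0, 1)`. -/
def vv (F : Type) [Field F] : Rg F := (0, 1)

/-- The element `v • x + (1 - v) • y` of `Rⁿ`, for `x, y ∈ Fⁿ`. -/
def mix {F : Type} [Field F] {n : ℕ} (x y : Fin n → F) : Fin n → Rg F :=
  fun i => vv F * algebraMap F (Rg F) (x i) + (1 - vv F) * algebraMap F (Rg F) (y i)

/-- `v A ⊕ (1 - v) B = {v a + (1-v) b : a ∈ A, b ∈ B}`. -/
def mixSet {F : Type} [Field F] {n : ℕ} (A B : Set (Fin n → F)) : Set (Fin n → Rg F) :=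
  {c | ∃ x ∈ A, ∃ y ∈ B, c = mix x y}

/-- Euclidean dual (of an arbitrary subset). -/
def dualE {K : Type} [CommRing K] {n : ℕ} (C : Set (Fin n → K)) : Set (Fin n → K) :=
  {x | ∀ y ∈ C, ∑ i, x i * y i = 0}

/-- Hermitian dual w.r.t. a conjugation map. -/
def dualH {K : Type} [CommRing K] (conj : K → K) {n : ℕ} (C : Set (Fin n → K)) :
    Set (Fin n → K) :=
  {x | ∀ y ∈ C, ∑ i, x i * conj (y i) = 0}

/-- The map `a + v b ↦ a ^ e + v * b ^ e` on `R` (i.e. the extension of `x ↦ x ^ e`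
from `F` to `R`); used for `θ_r` (`e = p ^ r`) and for conjugation (`e = p ^ (t/2)`). -/
def thR (F : Type) [Field F] (e : ℕ) : Rg F → Rg F :=
  fun z => (z.1 ^ e, z.1 ^ e + (z.2 - z.1) ^ e)

/-- The skew `λ`-constacyclic shift
`(c₀, …, c_{n-1}) ↦ (λ θ(c_{n-1}), θ(c₀), …, θ(c_{n-2}))`. -/
def skewShift {K : Type} [Mul K] (th : K → K) (lam : K) {n : ℕ} (c : Fin n → K) :
    Fin n → K :=
  fun i =>
    if (i : ℕ) = 0 then
      lam * th (c ⟨n - 1, Nat.sub_lt (Nat.lt_of_le_of_lt (Nat.zero_le _) i.isLt) Nat.one_pos⟩)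
    else th (c ⟨(i : ℕ) - 1, Nat.lt_of_le_of_lt (Nat.sub_le _ _) i.isLt⟩)

/-- A set of words is skew `λ`-constacyclic if it is stable under the skew shift. -/
def SkewConsta {K : Type} [Mul K] (th : K → K) (lam : K) {n : ℕ}
    (C : Set (Fin n → K)) : Prop :=
  ∀ c ∈ C, skewShift th lam c ∈ C

/-- `[i] = (p^{ri} - 1)/(p^r - 1) = 1 + p^r + ⋯ + p^{r(i-1)}` (so `[0] = 0`). -/
def brk (p r i : ℕ) : ℕ := ∑ j ∈ Finset.range i, p ^ (r * j)

/-- The monomial map `ψ_δ : (c₀, …, c_{n-1}) ↦ (δ^{[0]} c₀, …, δ^{[n-1]} c_{n-1})`. -/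
def psi {K : Type} [Monoid K] (p r : ℕ) (δ : K) {n : ℕ} (c : Fin n → K) : Fin n → K :=
  fun i => δ ^ brk p r (i : ℕ) * c i

/-- A set is a linear code over `K` if it is (the carrier of) a `K`-submodule. -/
def IsLinCode (K : Type) [Semiring K] {M : Type} [AddCommMonoid M] [Module K M]
    (S : Set M) : Prop :=
  ∃ C : Submodule K M, ↑C = S

/-- The Gray map `Φ(a + v b) = (a, a + b)`, componentwise; under the identification
`R = F × F` it is the canonical unzip `Rⁿ ≅ Fⁿ × Fⁿ`. -/
def gray {F : Type} [Field F] {n : ℕ} (c : Fin n → Rg F) : (Fin n → F) × (Fin n → F) :=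
  (fun i => (c i).1, fun i => (c i).2)

/-- Euclidean dual in `F^{2n} ≅ Fⁿ × Fⁿ` w.r.t. the standard inner product. -/
def dualProd {F : Type} [Field F] {n : ℕ} (S : Set ((Fin n → F) × (Fin n → F))) :
    Set ((Fin n → F) × (Fin n → F)) :=
  {x | ∀ y ∈ S, (∑ i, x.1 i * y.1 i) + (∑ i, x.2 i * y.2 i) = 0}

theorem mix_eq_prod {F : Type} [Field F] {n : ℕ} (x y : Fin n → F) :
    mix x y = fun i => (y i, x i) := by
  funext i
  ext <;> simp [mix, vv]

theorem mem_mixSet_iff {F : Type} [Field F] {n : ℕ} {A B : Set (Fin n → F)}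
    {c : Fin n → Rg F} :
    c ∈ mixSet A B ↔ (fun i => (c i).2) ∈ A ∧ (fun i => (c i).1) ∈ B := by
  constructor
  · rintro ⟨x, hx, y, hy, rfl⟩
    simpa [mix_eq_prod] using And.intro hx hy
  · rintro ⟨hA, hB⟩
    exact ⟨_, hA, _, hB, by rw [mix_eq_prod]⟩

theorem thR_pow_char {F : Type} [Field F] (p m : ℕ) [ExpChar F p] (z : Rg F) :
    thR F (p ^ m) z = (z.1 ^ p ^ m, z.2 ^ p ^ m) := by
  rw [thR, ← add_pow_expChar_pow, add_sub_cancel]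

theorem sum_mul_prodMap {F : Type} [Field F] {n : ℕ} (σ : F → F) (c : Fin n → Rg F)
    (x y : Fin n → F) :
    ∑ i, c i * (σ (y i), σ (x i)) =
      (∑ i, (c i).1 * σ (y i), ∑ i, (c i).2 * σ (x i)) := by
  ext <;> simp [Prod.fst_sum, Prod.snd_sum]

/-- `t` even: the Hermitian dual of `C = vC₁ ⊕ (1-v)C₂` is
`vC₁^{⊥_H} ⊕ (1-v)C₂^{⊥_H}`, where conjugation is `x ↦ x^{p^{t/2}}` on `F`,
extended to `R` by `(a + vb)‾ = ā + v b̄`. -/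
theorem stmt3 (p t n : ℕ) (hp : p.Prime) (ht : 0 < t) (hteven : 2 ∣ t)
    (F : Type) [Field F] [Fintype F] (hF : Fintype.card F = p ^ t)
    (C₁ C₂ : Submodule F (Fin n → F)) :
    dualH (thR F (p ^ (t / 2))) (mixSet (↑C₁ : Set (Fin n → F)) (↑C₂ : Set (Fin n → F))) =
      mixSet (dualH (fun a : F => a ^ p ^ (t / 2)) (↑C₁ : Set (Fin n → F)))
        (dualH (fun a : F => a ^ p ^ (t / 2)) (↑C₂ : Set (Fin n → F))) := by
  have : Fact p.Prime := ⟨hp⟩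
  have : CharP F p := charP_of_card_eq_prime_pow hF
  have : ExpChar F p := ExpChar.prime hp
  ext c
  rw [mem_mixSet_iff]
  constructor
  · intro h
    have key : ∀ x ∈ C₁, ∀ y ∈ C₂, ∑ i, (c i).1 * y i ^ p ^ (t / 2) = 0 ∧
        ∑ i, (c i).2 * x i ^ p ^ (t / 2) = 0 := by
      intro x hx y hy
      have hxy := h _ ⟨x, hx, y, hy, rfl⟩
      simp only [mix_eq_prod, thR_pow_char] at hxy
      rw [sum_mul_prodMap (fun a => a ^ p ^ (t / 2))] at hxy
      exact Prod.mk_eq_zero.mp hxy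
    exact ⟨fun x hx => (key x hx 0 C₂.zero_mem).2, fun y hy => (key 0 C₁.zero_mem y hy).1⟩
  · rintro ⟨h₁, h₂⟩ _ ⟨x, hx, y, hy, rfl⟩
    simp only [mix_eq_prod, thR_pow_char]
    rw [sum_mul_prodMap (fun a => a ^ p ^ (t / 2))]
    exact Prod.mk_eq_zero.mpr ⟨h₂ y hy, h₁ x hx⟩
end

section
/- Assume n is a multiple of t/r and suppose λ ∈ 𝔽_q^* satisfies λ = δ^{[n]} for some δ ∈ 𝔽_q^*. Then every skew λ-constacyclic code of length n over 𝔽_q (with respect to θ_r) is equivalent to a skew cyclic code of length n over 𝔽_q: the Hamming-weight-preserving 𝔽_q-linear bijection ψ_δ maps the set of skew λ-constacyclic codes of length n bijectively onto the set of skew cyclic codes of length n. -/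
open scoped BigOperators

theorem brk_succ (p r i : ℕ) : brk p r (i + 1) = brk p r i * p ^ r + 1 := by
  simp [brk, Finset.sum_range_succ', Finset.sum_mul, mul_add, pow_add]

/-- `ψ_δ` intertwines the skew `δ^{[n]}`-constacyclic shift with `δ` times the skew cyclic one. -/
theorem psi_skewShift {F : Type} [Field F] (p r : ℕ) {n : ℕ} (δ : F) (c : Fin n → F) :
    psi p r δ (skewShift (fun a : F => a ^ p ^ r) (δ ^ brk p r n) c) =
      δ • skewShift (fun a : F => a ^ p ^ r) 1 (psi p r δ c) := by
  funext i
  obtain ⟨i, hi⟩ := i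
  obtain ⟨m, rfl⟩ : ∃ m, n = m + 1 := ⟨n - 1, by omega⟩
  cases i with
  | zero =>
    simp only [psi, skewShift, Pi.smul_apply, smul_eq_mul, if_true, Nat.add_sub_cancel,
      brk_succ, mul_pow, pow_succ, pow_mul]
    simp [brk]
    ring
  | succ k =>
    simp only [psi, skewShift, Pi.smul_apply, smul_eq_mul, Nat.add_sub_cancel,
      brk_succ, mul_pow, pow_succ, pow_mul, Nat.succ_ne_zero, if_false]
    ring

theorem isLinearMap_psi {F : Type} [Field F] (p r : ℕ) (δ : F) {n : ℕ} :
    IsLinearMap F (psi p r δ (n := n)) where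
  map_add x y := by funext i; simp [psi, mul_add]
  map_smul a x := by funext i; simp [psi, mul_left_comm]

theorem psi_bijective {F : Type} [Field F] (p r : ℕ) {δ : F} (hδ : δ ≠ 0) {n : ℕ} :
    Function.Bijective (psi p r δ (n := n)) := by
  refine ⟨fun x y h => funext fun i => ?_, fun y => ⟨fun i => (δ ^ brk p r i)⁻¹ * y i, ?_⟩⟩
  · exact mul_left_cancel₀ (pow_ne_zero _ hδ) (congrFun h i)
  · funext i
    exact mul_inv_cancel_left₀ (pow_ne_zero _ hδ) (y i)

/-- if `n` is a multiple of `t/r` and `λ = δ^{[n]}` for some `δ ∈ 𝔽_q^*`,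
then the Hamming-weight-preserving `𝔽_q`-linear bijection `ψ_δ` maps the set of skew
`λ`-constacyclic codes of length `n` bijectively onto the set of skew cyclic codes, so
every skew `λ`-constacyclic code is equivalent to a skew cyclic code. -/
theorem stmt6 (p t r n : ℕ) (hp : p.Prime) (ht : 0 < t) (hr : r ∣ t) (hn : (t / r) ∣ n)
    (F : Type) [Field F] [Fintype F] [DecidableEq F] (hF : Fintype.card F = p ^ t)
    (lam δ : F) (hlam : lam ≠ 0) (hδ : δ ≠ 0) (hlamδ : lam = δ ^ brk p r n) :
    IsLinearMap F (psi p r δ (n := n)) ∧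
    Function.Bijective (psi p r δ (n := n)) ∧
    (∀ x : Fin n → F, hammingNorm (psi p r δ x) = hammingNorm x) ∧
    Set.BijOn (Set.image (psi p r δ))
      {S : Set (Fin n → F) | IsLinCode F S ∧ SkewConsta (fun a : F => a ^ p ^ r) lam S}
      {S : Set (Fin n → F) | IsLinCode F S ∧
        SkewConsta (fun a : F => a ^ p ^ r) (1 : F) S} := by
  subst hlamδ
  have hbij := psi_bijective p r hδ (n := n)
  have hlin := isLinearMap_psi p r δ (n := n)
  refine ⟨hlin, hbij, fun x => ?_, ?_, hbij.1.image_injective.injOn, ?_⟩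
  · simp [hammingNorm, psi, hδ]
  · rintro _ ⟨⟨C, rfl⟩, hC⟩
    refine ⟨⟨C.map hlin.mk', Submodule.map_coe _ _⟩, ?_⟩
    rintro _ ⟨c, hc, rfl⟩
    refine ⟨δ⁻¹ • skewShift (fun a : F => a ^ p ^ r) (δ ^ brk p r n) c,
      C.smul_mem _ (hC c hc), ?_⟩
    rw [hlin.map_smul, psi_skewShift, inv_smul_smul₀ hδ]
  · rintro _ ⟨⟨C, rfl⟩, hC⟩
    refine ⟨psi p r δ ⁻¹' C, ⟨⟨C.comap hlin.mk', rfl⟩, fun c hc => ?_⟩,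
      Set.image_preimage_eq _ hbij.2⟩
    rw [Set.mem_preimage, psi_skewShift]
    exact C.smul_mem _ (hC _ hc)
end

section
/- For linear codes C₁, C₂ of length n over 𝔽_q, the linear code C = vC₁ ⊕ (1−v)C₂ over R is an Euclidean LCD code over R if and only if C₁ and C₂ are both Euclidean LCD codes of length n over 𝔽_q. -/
open scoped BigOperators

theorem mix_apply {F : Type} [Field F] {n : ℕ} (x y : Fin n → F) (i : Fin n) :
    mix x y i = (y i, x i) := by
  ext <;> simp [mix, vv]

theorem mix_eq_mix_iff {F : Type} [Field F] {n : ℕ} {x y x' y' : Fin n → F} :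
    mix x y = mix x' y' ↔ x = x' ∧ y = y' := by
  simp only [funext_iff, mix_apply, Prod.mk.injEq, forall_and, and_comm]

theorem mix_zero_zero {F : Type} [Field F] {n : ℕ} : mix (0 : Fin n → F) 0 = 0 := by
  ext i <;> simp [mix_apply]

theorem sum_mix_mul_mix_eq_zero_iff {F : Type} [Field F] {n : ℕ} (x y a b : Fin n → F) :
    ∑ i, mix x y i * mix a b i = 0 ↔ ∑ i, x i * a i = 0 ∧ ∑ i, y i * b i = 0 := by
  simp only [mix_apply, Prod.ext_iff, Prod.fst_sum, Prod.snd_sum, Prod.mk_mul_mk,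
    Prod.fst_zero, Prod.snd_zero, and_comm]

theorem mix_mem_dualE_mixSet_iff {F : Type} [Field F] {n : ℕ} {A B : Set (Fin n → F)}
    (hA : A.Nonempty) (hB : B.Nonempty) (x y : Fin n → F) :
    mix x y ∈ dualE (mixSet A B) ↔ x ∈ dualE A ∧ y ∈ dualE B := by
  obtain ⟨a₀, ha₀⟩ := hA
  obtain ⟨b₀, hb₀⟩ := hB
  constructor
  · intro h
    have key : ∀ a ∈ A, ∀ b ∈ B, ∑ i, x i * a i = 0 ∧ ∑ i, y i * b i = 0 :=
      fun a ha b hb => (sum_mix_mul_mix_eq_zero_iff x y a b).1 (h _ ⟨a, ha, b, hb, rfl⟩)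
    exact ⟨fun a ha => (key a ha b₀ hb₀).1, fun b hb => (key a₀ ha₀ b hb).2⟩
  · rintro ⟨hx, hy⟩ _ ⟨a, ha, b, hb, rfl⟩
    exact (sum_mix_mul_mix_eq_zero_iff x y a b).2 ⟨hx a ha, hy b hb⟩

theorem mixSet_inter_dualE {F : Type} [Field F] {n : ℕ} {A B : Set (Fin n → F)}
    (hA : A.Nonempty) (hB : B.Nonempty) :
    mixSet A B ∩ dualE (mixSet A B) = mixSet (A ∩ dualE A) (B ∩ dualE B) := by
  ext c
  constructor
  · rintro ⟨⟨x, hx, y, hy, rfl⟩, h⟩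
    obtain ⟨h₁, h₂⟩ := (mix_mem_dualE_mixSet_iff hA hB x y).1 h
    exact ⟨x, ⟨hx, h₁⟩, y, ⟨hy, h₂⟩, rfl⟩
  · rintro ⟨x, ⟨hx, h₁⟩, y, ⟨hy, h₂⟩, rfl⟩
    exact ⟨⟨x, hx, y, hy, rfl⟩, (mix_mem_dualE_mixSet_iff hA hB x y).2 ⟨h₁, h₂⟩⟩

theorem mixSet_eq_image2 {F : Type} [Field F] {n : ℕ} (A B : Set (Fin n → F)) :
    mixSet A B = Set.image2 mix A B := by
  ext c
  simp only [mixSet, Set.mem_ofPred_eq, Set.mem_image2, eq_comm]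

theorem mixSet_eq_singleton_zero_iff {F : Type} [Field F] {n : ℕ} {A B : Set (Fin n → F)} :
    mixSet A B = {0} ↔ A = {0} ∧ B = {0} := by
  rw [mixSet_eq_image2]
  constructor
  · intro h
    obtain ⟨hA, hB⟩ := Set.image2_nonempty_iff.1 (h ▸ Set.singleton_nonempty _)
    have key : ∀ a ∈ A, ∀ b ∈ B, a = 0 ∧ b = 0 := fun a ha b hb =>
      mix_eq_mix_iff.1 ((h.subset (Set.mem_image2_of_mem ha hb)).trans mix_zero_zero.symm)
    obtain ⟨a₀, ha₀⟩ := hA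
    obtain ⟨b₀, hb₀⟩ := hB
    exact ⟨Set.eq_singleton_iff_nonempty_unique_mem.2
        ⟨⟨a₀, ha₀⟩, fun a ha => (key a ha b₀ hb₀).1⟩,
      Set.eq_singleton_iff_nonempty_unique_mem.2
        ⟨⟨b₀, hb₀⟩, fun b hb => (key a₀ ha₀ b hb).2⟩⟩
  · rintro ⟨rfl, rfl⟩
    rw [Set.image2_singleton, mix_zero_zero]

/-- `C = vC₁ ⊕ (1-v)C₂` is an Euclidean LCD code over `R` iff
`C₁` and `C₂` are Euclidean LCD codes over `𝔽_q`. -/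
theorem stmt12 (p t n : ℕ) (hp : p.Prime) (ht : 0 < t)
    (F : Type) [Field F] [Fintype F] (hF : Fintype.card F = p ^ t)
    (C₁ C₂ : Submodule F (Fin n → F)) :
    mixSet (↑C₁ : Set (Fin n → F)) (↑C₂ : Set (Fin n → F)) ∩
        dualE (mixSet (↑C₁ : Set (Fin n → F)) (↑C₂ : Set (Fin n → F))) = {0} ↔
      (↑C₁ : Set (Fin n → F)) ∩ dualE (↑C₁ : Set (Fin n → F)) = {0} ∧
      (↑C₂ : Set (Fin n → F)) ∩ dualE (↑C₂ : Set (Fin n → F)) = {0} := by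
  rw [mixSet_inter_dualE C₁.nonempty C₂.nonempty, mixSet_eq_singleton_zero_iff]
end
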